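/- Let G be a finite tree with n ≥ 2 vertices whose maximum degree and diameter are both at most C·log n (with C > 0 and n large enough so that n/(2^{N-1}·C·log n) ≥ √n where N = ⌊(log n)^{3/4}⌋). Then, by repeatedly applying the edge-splitting lemma, G contains N pairwise disjoint connected subtrees H_1, ..., H_N each with at least √n vertices. -/

import Mathlib

def RR {V : Type*} (G : SimpleGraph V) (T : Finset V) : V → V → Prop :=
  Relation.ReflTransGen (fun a b => G.Adj a b ∧ a ∈ T ∧ b ∈ T)

def Cn {V : Type*} (G : SimpleGraph V) (T : Finset V) : Prop :=
  ∀ x ∈ T, ∀ y ∈ T, RR G T x y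

theorem RR_mono {V : Type*} {G : SimpleGraph V} {S T : Finset V} (h : S ⊆ T) {x y : V}
    (hr : RR G S x y) : RR G T x y := by
  induction hr with
  | refl => exact Relation.ReflTransGen.refl
  | tail _ hab ih => exact Relation.ReflTransGen.tail ih ⟨hab.1, h hab.2.1, h hab.2.2⟩

theorem RR_symm {V : Type*} {G : SimpleGraph V} {T : Finset V} {x y : V}
    (hr : RR G T x y) : RR G T y x := by
  induction hr with
  | refl => exact Relation.ReflTransGen.refl
  | tail _ h ih => exact Relation.ReflTransGen.head ⟨h.1.symm, h.2.2, h.2.1⟩ ih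

theorem Cn_of_root {V : Type*} {G : SimpleGraph V} {T : Finset V} (v : V)
    (h : ∀ y ∈ T, RR G T v y) : Cn G T := fun x hx y hy =>
  Relation.ReflTransGen.trans (RR_symm (h x hx)) (h y hy)

open Classical in
noncomputable def KK {V : Type*} (G : SimpleGraph V) (T : Finset V) (w : V) : Finset V :=
  T.filter (fun x => RR G T w x)

theorem mem_KK {V : Type*} {G : SimpleGraph V} {T : Finset V} {w x : V} :
    x ∈ KK G T w ↔ x ∈ T ∧ RR G T w x := by
  unfold KK; simp

theorem RR_KK {V : Type*} {G : SimpleGraph V} {T : Finset V} {w x : V}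
    (hr : RR G T w x) : RR G (KK G T w) w x := by
  induction hr with
  | refl => exact Relation.ReflTransGen.refl
  | tail h1 h ih =>
    exact Relation.ReflTransGen.tail ih
      ⟨h.1, mem_KK.2 ⟨h.2.1, h1⟩, mem_KK.2 ⟨h.2.2, Relation.ReflTransGen.tail h1 h⟩⟩

theorem exists_nbr {V : Type*} [DecidableEq V] {G : SimpleGraph V} {A : Finset V} {v y : V}
    (hr : RR G A v y) : y = v ∨ ∃ w ∈ A.erase v, G.Adj v w ∧ RR G (A.erase v) w y := by
  induction hr with
  | refl => exact Or.inl rfl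
  | @tail b c h1 h ih =>
    by_cases hc : c = v
    · exact Or.inl hc
    right
    have hcA : c ∈ A.erase v := Finset.mem_erase.2 ⟨hc, h.2.2⟩
    by_cases hb : b = v
    · subst hb
      exact ⟨c, hcA, h.1, Relation.ReflTransGen.refl⟩
    · rcases ih with ih | ⟨w, hw, hvw, hwb⟩
      · exact absurd ih hb
      · exact ⟨w, hw, hvw, Relation.ReflTransGen.tail hwb
          ⟨h.1, Finset.mem_erase.2 ⟨hb, h.2.1⟩, hcA⟩⟩

theorem exists_cross {V : Type*} {G : SimpleGraph V} {S A : Finset V} {a y : V}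
    (ha : a ∈ A) (hr : RR G S a y) : y ∈ A ∨ ∃ v ∈ A, ∃ u ∈ S, u ∉ A ∧ G.Adj v u := by
  induction hr with
  | refl => exact Or.inl ha
  | @tail b c h1 h ih =>
    rcases ih with ih | ih
    · by_cases hc : c ∈ A
      · exact Or.inl hc
      · exact Or.inr ⟨b, ih, c, h.2.2, hc, h.1⟩
    · exact Or.inr ih

theorem split_aux {V : Type*} [Fintype V] [DecidableEq V] {G : SimpleGraph V} [DecidableRel G.Adj]
    (d s : ℕ) (hd : 1 ≤ d) (hs : 1 ≤ s) (hdeg : ∀ v, G.degree v ≤ d) (S : Finset V)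
    (hS : Cn G S) : ∀ m : ℕ, ∀ A : Finset V, A.card = m → A ⊆ S → Cn G A → Cn G (S \ A) →
      s ≤ A.card → ∃ A' ⊆ S, Cn G A' ∧ Cn G (S \ A') ∧ s ≤ A'.card ∧ A'.card ≤ d * s := by
  intro m
  induction m using Nat.strong_induction_on with
  | _ m ih =>
  intro A hm hAS hA hB hsA
  by_cases hle : A.card ≤ d * s
  · exact ⟨A, hAS, hA, hB, hsA, hle⟩
  have hAne : A.Nonempty := Finset.card_pos.1 (by omega)
  -- choose the vertex
  have hv : ∃ v ∈ A, ∀ y ∈ S \ A, ∃ u ∈ S \ A, G.Adj v u := by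
    obtain ⟨a, ha⟩ := hAne
    by_cases hBe : ∃ b, b ∈ S \ A
    · obtain ⟨b, hb⟩ := hBe
      rw [Finset.mem_sdiff] at hb
      rcases exists_cross ha (hS a (hAS ha) b hb.1) with h | ⟨v, hv, u, hu, huA, hvu⟩
      · exact absurd h hb.2
      · exact ⟨v, hv, fun _ _ => ⟨u, Finset.mem_sdiff.2 ⟨hu, huA⟩, hvu⟩⟩
    · exact ⟨a, ha, fun y hy => absurd ⟨y, hy⟩ hBe⟩
  obtain ⟨v, hvA, hvB⟩ := hv
  set T := A.erase v with hT
  have hTA : T ⊆ A := Finset.erase_subset _ _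
  have hcov : T ⊆ (G.neighborFinset v).biUnion (fun w => KK G T w) := by
    intro y hy
    rcases exists_nbr (hA v hvA y (hTA hy)) with h | ⟨w, hw, hvw, hwy⟩
    · exact absurd h (Finset.ne_of_mem_erase hy)
    · exact Finset.mem_biUnion.2 ⟨w, by simpa using hvw, mem_KK.2 ⟨hy, hwy⟩⟩
  have hbig : ∃ w ∈ G.neighborFinset v, s ≤ (KK G T w).card := by
    by_contra! hcon
    have h1 := Finset.card_le_card hcov
    have h2 := Finset.card_biUnion_le_card_mul (G.neighborFinset v) (fun w => KK G T w) (s - 1)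
      (fun w hw => by have := hcon w hw; omega)
    have h3 : (G.neighborFinset v).card * (s - 1) ≤ d * (s - 1) :=
      Nat.mul_le_mul_right _ (by simpa using hdeg v)
    have h4 : T.card = A.card - 1 := Finset.card_erase_of_mem hvA
    obtain ⟨t, rfl⟩ : ∃ t, s = t + 1 := ⟨s - 1, by omega⟩
    simp only [Nat.add_sub_cancel] at h2 h3
    rw [Nat.mul_succ] at hle
    omega
  obtain ⟨w, _, hwK⟩ := hbig
  have hKT : KK G T w ⊆ T := fun x hx => (mem_KK.1 hx).1
  have hvT : v ∉ T := Finset.notMem_erase v A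
  have hvK : v ∈ S \ KK G T w := Finset.mem_sdiff.2 ⟨hAS hvA, fun h => hvT (hKT h)⟩
  refine ih (KK G T w).card ?_ (KK G T w) rfl ((hKT.trans hTA).trans hAS) ?_ ?_ hwK
  · have := Finset.card_le_card hKT
    have h4 : T.card < A.card := Finset.card_erase_lt_of_mem hvA
    omega
  · exact Cn_of_root w (fun y hy => RR_KK (mem_KK.1 hy).2)
  · refine Cn_of_root v ?_
    intro y hy
    rw [Finset.mem_sdiff] at hy
    by_cases hyA : y ∈ A
    · rcases exists_nbr (hA v hvA y hyA) with rfl | ⟨w', hw', hvw, hwy⟩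
      · exact Relation.ReflTransGen.refl
      · have hyT : y ∈ T := by
          refine Finset.mem_erase.2 ⟨?_, hyA⟩
          rintro rfl
          rcases Relation.ReflTransGen.cases_tail hwy with h | ⟨c, _, h⟩
          · rw [← h] at hw'; exact hvT hw' |>.elim
          · exact hvT h.2.2
        have hsub : KK G T w' ⊆ S \ KK G T w := by
          intro x hx
          refine Finset.mem_sdiff.2 ⟨hAS (hTA (mem_KK.1 hx).1), fun hxK => hy.2 ?_⟩
          exact mem_KK.2 ⟨hyT, Relation.ReflTransGen.trans (mem_KK.1 hxK).2
            (Relation.ReflTransGen.trans (RR_symm (mem_KK.1 hx).2) hwy)⟩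
        exact Relation.ReflTransGen.head
          ⟨hvw, hvK, hsub (mem_KK.2 ⟨hw', Relation.ReflTransGen.refl⟩)⟩
          (RR_mono hsub (RR_KK hwy))
    · have hyB : y ∈ S \ A := Finset.mem_sdiff.2 ⟨hy.1, hyA⟩
      obtain ⟨u, hu, hvu⟩ := hvB y hyB
      have hsub : S \ A ⊆ S \ KK G T w := Finset.sdiff_subset_sdiff le_rfl (hKT.trans hTA)
      exact Relation.ReflTransGen.head ⟨hvu, hvK, hsub hu⟩ (RR_mono hsub (hB u hu y hyB))

theorem many_aux {V : Type*} [Fintype V] [DecidableEq V] {G : SimpleGraph V} [DecidableRel G.Adj]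
    (d s : ℕ) (hd : 1 ≤ d) (hs : 1 ≤ s) (hdeg : ∀ v, G.degree v ≤ d) : ∀ (k : ℕ) (S : Finset V),
    Cn G S → k * (d * s) ≤ S.card → ∃ H : Fin k → Finset V,
      (Pairwise fun i j => Disjoint (H i) (H j)) ∧ ∀ i, H i ⊆ S ∧ Cn G (H i) ∧ s ≤ (H i).card := by
  intro k
  induction k with
  | zero => exact fun S _ _ => ⟨fun _ => ∅, fun i => i.elim0, fun i => i.elim0⟩
  | succ k ih =>
    intro S hS hcard
    rw [Nat.succ_mul] at hcard
    have hds : s ≤ d * s := Nat.le_mul_of_pos_left s hd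
    obtain ⟨A, hAS, hA, hB, hsA, hAd⟩ := split_aux d s hd hs hdeg S hS S.card S rfl le_rfl hS
      (by intro x hx; simp at hx) (by omega)
    have hc := Finset.card_sdiff_of_subset hAS
    obtain ⟨H, hH1, hH2⟩ := ih (S \ A) hB (by omega)
    have hdis : ∀ i, Disjoint A (H i) := fun i =>
      Finset.disjoint_of_subset_right (hH2 i).1 Finset.disjoint_sdiff
    refine ⟨Fin.cons A H, ?_, ?_⟩
    · intro i j hij
      induction i using Fin.cases with
      | zero =>
        induction j using Fin.cases with
        | zero => exact absurd rfl hij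
        | succ j => simpa using hdis j
      | succ i =>
        induction j using Fin.cases with
        | zero => simpa using (hdis i).symm
        | succ j => simpa using hH1 (fun h => hij (by rw [h]))
    · intro i
      induction i using Fin.cases with
      | zero => simpa using ⟨hAS, hA, hsA⟩
      | succ i => simpa using ⟨(hH2 i).1.trans Finset.sdiff_subset, (hH2 i).2⟩

theorem Cn_induce {V : Type*} {G : SimpleGraph V} {T : Finset V} (h : Cn G T)
    (hne : T.Nonempty) : (G.induce (T : Set V)).Connected := by
  have : Nonempty (T : Set V) := hne.to_subtype
  refine SimpleGraph.Connected.mk ?_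
  rintro ⟨x, hx⟩ ⟨y, hy⟩
  have key : ∀ z, RR G T x z → ∃ hz : z ∈ (T : Set V),
      (G.induce (T : Set V)).Reachable ⟨x, hx⟩ ⟨z, hz⟩ := by
    intro z hz
    induction hz with
    | refl => exact ⟨hx, SimpleGraph.Reachable.refl _⟩
    | tail _ h ih =>
      obtain ⟨hb, hr⟩ := ih
      refine ⟨h.2.2, hr.trans (SimpleGraph.Adj.reachable ?_)⟩
      simpa using h.1
  exact (key y (h x hx y hy)).2

theorem stmt_6 {V : Type*} [Fintype V] {G : SimpleGraph V} [DecidableRel G.Adj]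
    (hT : G.IsTree) (n : ℕ) (hn : Fintype.card V = n) (hn2 : 2 ≤ n) (C : ℝ) (hC : 0 < C)
    (hdeg : ∀ v : V, (G.degree v : ℝ) ≤ C * Real.log n)
    (hdiam : ∀ u v : V, (G.dist u v : ℝ) ≤ C * Real.log n)
    (hlarge : ∀ i : ℕ, 1 ≤ i → i ≤ ⌊(Real.log n) ^ ((3 : ℝ) / 4)⌋₊ →
      Real.sqrt n ≤ (⌊(n : ℝ) / ((2 : ℝ) ^ (i - 1) * (C * Real.log n))⌋₊ : ℝ)) :
    ∃ H : Fin ⌊(Real.log n) ^ ((3 : ℝ) / 4)⌋₊ → Set V,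
      (Pairwise fun i j => Disjoint (H i) (H j)) ∧
      ∀ i, (G.induce (H i)).Connected ∧ Real.sqrt n ≤ ((H i).ncard : ℝ) := by
  classical
  generalize ⌊(Real.log n) ^ ((3 : ℝ) / 4)⌋₊ = N at *
  have hn2' : (2 : ℝ) ≤ n := by exact_mod_cast hn2
  have hD : 0 < C * Real.log n := mul_pos hC (Real.log_pos (by linarith))
  generalize C * Real.log n = D at *
  have hsq : 0 < Real.sqrt n := Real.sqrt_pos.2 (by linarith)
  have hs : 1 ≤ ⌈Real.sqrt n⌉₊ := Nat.ceil_pos.2 hsq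
  have hdeg' : ∀ v, G.degree v ≤ ⌊D⌋₊ := fun v => Nat.le_floor (hdeg v)
  have : Nontrivial V := Fintype.one_lt_card_iff_nontrivial.1 (by omega)
  have hd : 1 ≤ ⌊D⌋₊ := by
    obtain ⟨v⟩ := hT.connected.nonempty
    exact le_trans (hT.connected.preconnected.degree_pos_of_nontrivial v) (hdeg' v)
  have hcard : N * (⌊D⌋₊ * ⌈Real.sqrt n⌉₊) ≤ (Finset.univ : Finset V).card := by
    rw [Finset.card_univ, hn]
    rcases Nat.eq_zero_or_pos N with h0 | hpos
    · simp [h0]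
    have h1 := Nat.ceil_le.2 (hlarge N hpos le_rfl)
    have h2 : (⌈Real.sqrt n⌉₊ : ℝ) ≤ (n : ℝ) / ((2 : ℝ) ^ (N - 1) * D) :=
      le_trans (by exact_mod_cast h1) (Nat.floor_le (by positivity))
    rw [le_div_iff₀ (by positivity)] at h2
    have h3 : N ≤ 2 ^ (N - 1) := by
      have := Nat.lt_two_pow_self (n := N - 1); omega
    have h3' : (N : ℝ) ≤ 2 ^ (N - 1) := by exact_mod_cast h3
    have h4 : (⌊D⌋₊ : ℝ) ≤ D := Nat.floor_le hD.le
    have h5 : ((N * (⌊D⌋₊ * ⌈Real.sqrt n⌉₊) : ℕ) : ℝ) ≤ n := by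
      push_cast
      calc (N : ℝ) * (⌊D⌋₊ * ⌈Real.sqrt n⌉₊) ≤ 2 ^ (N - 1) * (D * ⌈Real.sqrt n⌉₊) := by gcongr
        _ = ⌈Real.sqrt n⌉₊ * (2 ^ (N - 1) * D) := by ring
        _ ≤ n := h2
    exact_mod_cast h5
  have hV : Cn G (Finset.univ : Finset V) := by
    intro x _ y _
    have := (SimpleGraph.reachable_iff_reflTransGen x y).1 (hT.connected.preconnected x y)
    induction this with
    | refl => exact Relation.ReflTransGen.refl
    | tail _ h ih =>
      exact Relation.ReflTransGen.tail (ih (Finset.mem_univ _))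
        ⟨h, Finset.mem_univ _, Finset.mem_univ _⟩
  obtain ⟨H, hH1, hH2⟩ := many_aux _ _ hd hs hdeg' N Finset.univ hV hcard
  refine ⟨fun i => (H i : Set V), fun i j hij => ?_, fun i => ⟨?_, ?_⟩⟩
  · exact Finset.disjoint_coe.2 (hH1 hij)
  · exact Cn_induce (hH2 i).2.1 (Finset.card_pos.1 (by have := (hH2 i).2.2; omega))
  · rw [Set.ncard_coe_finset]
    exact (Nat.le_ceil _).trans (by exact_mod_cast (hH2 i).2.2)
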